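/- Let Z = X × {0,1} be a finite example domain, D a distribution on Z, m ∈ ℕ, and S = (Z_1,…,Z_m) ~ D^m an i.i.d. sample. Let h be a random variable taking values in hypotheses X → {0,1}, jointly distributed with S. If I(S; h) ≤ d (in bits), then E[ err(h; D) − êrr(h; S) ] ≤ √(d/m), where the expectation is over the joint distribution of (S, h). -/

import Mathlib

open scoped Classical

/-- Shannon entropy (in bits) of a distribution given by a weight function on a finite type. -/
noncomputable def ent {α : Type*} [Fintype α] (p : α → ℝ) : ℝ :=
  - ∑ a, p a * Real.logb 2 (p a)

/-- Mutual information (in bits) between the two coordinates of a joint distribution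
given by a weight function on a finite product type. -/
noncomputable def mutInfo {α β : Type*} [Fintype α] [Fintype β] (μ : α × β → ℝ) : ℝ :=
  ent (fun a => ∑ b, μ (a, b)) + ent (fun b => ∑ a, μ (a, b)) - ent μ

/-- True error of a hypothesis `h : X → Bool` with respect to a distribution `D` on
`X × Bool`. -/
noncomputable def trueErr {X : Type*} [Fintype X] (D : X × Bool → ℝ) (h : X → Bool) : ℝ :=
  ∑ z, D z * (if h z.1 ≠ z.2 then (1 : ℝ) else 0)

/-- Empirical error of a hypothesis `h : X → Bool` on a sample `S` of size `m`. -/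
noncomputable def empErr {X : Type*} {m : ℕ} (S : Fin m → X × Bool) (h : X → Bool) : ℝ :=
  (1 / (m : ℝ)) * ∑ i, (if h (S i).1 ≠ (S i).2 then (1 : ℝ) else 0)

/-- Hoeffding's lemma for a weight function on a finite type. -/
lemma sum_mul_exp_le_of_mem_Icc {Z : Type*} [Fintype Z] (D : Z → ℝ) (hD0 : ∀ z, 0 ≤ D z)
    (hD1 : ∑ z, D z = 1) (b : Z → ℝ) (hb : ∀ z, b z ∈ Set.Icc (0 : ℝ) 1) (t : ℝ) :
    ∑ z, D z * Real.exp (t * (∑ w, D w * b w - b z)) ≤ Real.exp (t ^ 2 / 8) := by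
  let _ : MeasurableSpace Z := ⊤
  let ν : MeasureTheory.Measure Z :=
    ∑ z, ENNReal.ofReal (D z) • MeasureTheory.Measure.dirac z
  have hν : MeasureTheory.IsProbabilityMeasure ν := ⟨by
    simp [ν, ← ENNReal.ofReal_sum_of_nonneg (fun z _ => hD0 z), hD1]⟩
  have hint (f : Z → ℝ) : ∫ z, f z ∂ν = ∑ z, D z * f z := by
    rw [MeasureTheory.integral_finsetSum_measure
      (fun z _ => MeasureTheory.Integrable.of_finite.smul_measure ENNReal.ofReal_ne_top)]
    simp [MeasureTheory.integral_smul_measure, ENNReal.toReal_ofReal, hD0]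
  have hsub := ProbabilityTheory.hasSubgaussianMGF_of_mem_Icc (μ := ν) (X := b)
    (measurable_from_top.aemeasurable) (Filter.Eventually.of_forall hb)
  have hle := hsub.mgf_le (-t)
  rw [ProbabilityTheory.mgf, hint, hint] at hle
  convert hle using 2
  · ring_nf
  · norm_num
    ring

/-- Entropy in bits times `log 2` is entropy in nats. -/
lemma ent_mul_log_two {α : Type*} [Fintype α] (p : α → ℝ) :
    ent p * Real.log 2 = - ∑ a, p a * Real.log (p a) := by
  have h2 : Real.log 2 ≠ 0 := (Real.log_pos one_lt_two).ne'
  simp only [ent, neg_mul, Finset.sum_mul, Real.logb]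
  congr 1
  refine Finset.sum_congr rfl fun a _ => ?_
  field_simp

/-- The variational bound on mutual information: an exponential moment under the product of the
marginals controls the expectation under the joint distribution. -/
lemma sum_mul_le_mutInfo_add {α β : Type*} [Fintype α] [Fintype β] (μ : α × β → ℝ)
    (hμ0 : ∀ p, 0 ≤ μ p) (hμ1 : ∑ p, μ p = 1) (f : α × β → ℝ) (c : ℝ)
    (hf : ∑ p : α × β, (∑ b, μ (p.1, b)) * (∑ a, μ (a, p.2)) * Real.exp (f p) ≤ Real.exp c) :
    ∑ p, μ p * f p ≤ mutInfo μ * Real.log 2 + c := by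
  set P : α → ℝ := fun a => ∑ b, μ (a, b) with hP
  set Q : β → ℝ := fun b => ∑ a, μ (a, b) with hQ
  have hmut : mutInfo μ * Real.log 2 =
      ∑ p : α × β, μ p * (Real.log (μ p) - Real.log (P p.1) - Real.log (Q p.2)) := by
    have hα : ∑ a, P a * Real.log (P a) = ∑ p : α × β, μ p * Real.log (P p.1) := by
      simp only [Fintype.sum_prod_type, ← Finset.sum_mul, hP]
    have hβ : ∑ b, Q b * Real.log (Q b) = ∑ p : α × β, μ p * Real.log (Q p.2) := by
      simp only [Fintype.sum_prod_type_right, ← Finset.sum_mul, hQ]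
    simp only [mutInfo, sub_mul, add_mul, mul_sub, Finset.sum_sub_distrib]
    rw [← hP, ← hQ, ent_mul_log_two, ent_mul_log_two, ent_mul_log_two, hα, hβ]
    ring
  have hpt (p : α × β) :
      μ p * f p - μ p * (Real.log (μ p) - Real.log (P p.1) - Real.log (Q p.2)) - c * μ p ≤
        P p.1 * Q p.2 * Real.exp (f p) * Real.exp (-c) - μ p := by
    have hP0 : μ p ≤ P p.1 :=
      Finset.single_le_sum (f := fun b => μ (p.1, b)) (fun _ _ => hμ0 _) (Finset.mem_univ p.2)
    have hQ0 : μ p ≤ Q p.2 :=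
      Finset.single_le_sum (f := fun a => μ (a, p.2)) (fun _ _ => hμ0 _) (Finset.mem_univ p.1)
    rcases (hμ0 p).eq_or_lt with h0 | h0
    · rw [← h0] at hP0 hQ0 ⊢
      simp only [zero_mul, mul_zero, sub_zero]
      positivity
    · have hPp : 0 < P p.1 := h0.trans_le hP0
      have hQp : 0 < Q p.2 := h0.trans_le hQ0
      have hlog := Real.log_le_sub_one_of_pos
        (x := P p.1 * Q p.2 * Real.exp (f p) * Real.exp (-c) / μ p) (by positivity)
      rw [Real.log_div (by positivity) h0.ne', Real.log_mul (by positivity) (by positivity),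
        Real.log_mul (by positivity) (by positivity), Real.log_mul hPp.ne' hQp.ne',
        Real.log_exp, Real.log_exp] at hlog
      have hmul := mul_le_mul_of_nonneg_left hlog h0.le
      rw [mul_sub, mul_sub _ (_ / _), mul_div_cancel₀ _ h0.ne'] at hmul
      linarith
  have hsum := Finset.sum_le_sum fun p (_ : p ∈ Finset.univ) => hpt p
  simp only [Finset.sum_sub_distrib (f := fun p : α × β => _ - _),
    Finset.sum_sub_distrib, ← Finset.mul_sum, ← Finset.sum_mul, hμ1] at hsum
  have hexp := mul_le_mul_of_nonneg_right hf (Real.exp_pos (-c)).le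
  rw [← Real.exp_add, add_neg_cancel, Real.exp_zero] at hexp
  rw [hmut]
  linarith

/-- The generalization gap of a fixed hypothesis on an i.i.d. sample is subgaussian. -/
lemma sum_prod_mul_exp_gap_le {X : Type*} [Fintype X] {m : ℕ} (hm : 0 < m)
    (D : X × Bool → ℝ) (hD0 : ∀ z, 0 ≤ D z) (hD1 : ∑ z, D z = 1) (h : X → Bool) (t : ℝ) :
    ∑ s : Fin m → X × Bool, (∏ i, D (s i)) * Real.exp (t * (trueErr D h - empErr s h)) ≤
      Real.exp (t ^ 2 / (8 * m)) := by
  have hm' : (m : ℝ) ≠ 0 := by positivity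
  set b : X × Bool → ℝ := fun z => if h z.1 ≠ z.2 then 1 else 0 with hb
  have hbI (z : X × Bool) : b z ∈ Set.Icc (0 : ℝ) 1 := by
    simp only [hb]
    split_ifs <;> simp
  have hfac (s : Fin m → X × Bool) :
      (∏ i, D (s i)) * Real.exp (t * (trueErr D h - empErr s h)) =
        ∏ i, D (s i) * Real.exp (t / m * (∑ w, D w * b w - b (s i))) := by
    rw [Finset.prod_mul_distrib, ← Real.exp_sum, ← Finset.mul_sum, Finset.sum_sub_distrib]
    have htrue : trueErr D h = ∑ w, D w * b w := rfl
    have hemp : empErr s h = 1 / (m : ℝ) * ∑ i, b (s i) := rfl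
    rw [htrue, hemp, Finset.sum_const, Finset.card_univ, Fintype.card_fin, nsmul_eq_mul]
    congr 2
    field_simp
  simp only [hfac]
  rw [← Fintype.sum_pow (fun z => D z * Real.exp (t / m * (∑ w, D w * b w - b z)))]
  refine (pow_le_pow_left₀ (Finset.sum_nonneg fun z _ => mul_nonneg (hD0 z) (Real.exp_pos _).le)
    (sum_mul_exp_le_of_mem_Icc D hD0 hD1 b hbI (t / m)) m).trans_eq ?_
  rw [← Real.exp_nat_mul]
  congr 1
  field_simp

/-- If the joint distribution `μ` of (sample `S ~ D^m`, hypothesis `h`)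
has mutual information at most `d` bits, then the expected generalization gap satisfies
`E[err(h; D) − êrr(h; S)] ≤ √(d/m)`. -/
theorem stmt15 {X : Type*} [Fintype X] [DecidableEq X] (m : ℕ) (hm : 0 < m) (d : ℝ)
    (D : X × Bool → ℝ) (hD0 : ∀ z, 0 ≤ D z) (hD1 : ∑ z, D z = 1)
    (μ : (Fin m → X × Bool) × (X → Bool) → ℝ)
    (hμ0 : ∀ p, 0 ≤ μ p) (hμ1 : ∑ p, μ p = 1)
    (hmarg : ∀ s, (∑ h, μ (s, h)) = ∏ i, D (s i))
    (hI : mutInfo μ ≤ d) :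
    ∑ p, μ p * (trueErr D p.2 - empErr p.1 p.2) ≤ Real.sqrt (d / m) := by
  have hm' : (0 : ℝ) < m := by exact_mod_cast hm
  set G := ∑ p, μ p * (trueErr D p.2 - empErr p.1 p.2) with hG
  have key (t : ℝ) : t * G ≤ mutInfo μ * Real.log 2 + t ^ 2 / (8 * m) := by
    rw [hG, Finset.mul_sum]
    simp only [mul_left_comm t]
    refine sum_mul_le_mutInfo_add μ hμ0 hμ1
      (fun p => t * (trueErr D p.2 - empErr p.1 p.2)) _ ?_
    simp only [hmarg]
    rw [Fintype.sum_prod_type_right]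
    calc _ = ∑ h, (∑ a, μ (a, h)) * ∑ s : Fin m → X × Bool,
          (∏ i, D (s i)) * Real.exp (t * (trueErr D h - empErr s h)) := by
          refine Finset.sum_congr rfl fun h _ => ?_
          rw [Finset.mul_sum]
          exact Finset.sum_congr rfl fun s _ => by ring
      _ ≤ ∑ h, (∑ a, μ (a, h)) * Real.exp (t ^ 2 / (8 * m)) :=
          Finset.sum_le_sum fun h _ => mul_le_mul_of_nonneg_left
            (sum_prod_mul_exp_gap_le hm D hD0 hD1 h t) (Finset.sum_nonneg fun a _ => hμ0 _)
      _ = _ := by rw [← Finset.sum_mul, ← Fintype.sum_prod_type_right, hμ1, one_mul]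
  have hlog0 : 0 < Real.log 2 := Real.log_pos one_lt_two
  have hlog1 : Real.log 2 < 1 := Real.log_two_lt_d9.trans (by norm_num)
  have hI0 : 0 ≤ mutInfo μ := by
    have h0 := key 0
    simp only [zero_mul, ne_eq, OfNat.ofNat_ne_zero, not_false_eq_true, zero_pow, zero_div,
      add_zero] at h0
    exact nonneg_of_mul_nonneg_left h0 hlog0
  refine Real.le_sqrt_of_sq_le ?_
  rw [le_div_iff₀ hm']
  have hk := key (4 * m * G)
  have hsq : (4 * m * G) ^ 2 / (8 * m) = 2 * (G ^ 2 * m) := by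
    field_simp
    ring
  rw [hsq] at hk
  nlinarith [mul_nonneg (sq_nonneg G) hm'.le, mul_le_mul_of_nonneg_left hlog1.le hI0]
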